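/- arXiv:2006.02520 — 3 statements merged into one kernel-verified Lean document; each statement's English description precedes it below -/
import Mathlib

section
/- Let (J^𝒢,(g_n)) be a unimodal nonautonomous discrete dynamical system satisfying the limit property. Then for every ε>0 there exist k≥1 and N≥1 such that for all n≥N the set 𝒞_n^k(𝒢) is ε-dense in J^𝒢, i.e., every point of J^𝒢 is within distance ε of some point of 𝒞_n^k(𝒢). -/
open Set

noncomputable section

/-- The nonautonomous iterate `f_n^ℓ = f_{n+ℓ-1} ∘ ⋯ ∘ f_n` (and `f_n^0 = id`). -/
def iterFrom (f : ℕ → ℝ → ℝ) : ℕ → ℕ → ℝ → ℝ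
  | _, 0, x => x
  | n, ℓ + 1, x => f (n + ℓ) (iterFrom f n ℓ x)

/-- `(Icc a b, (f n))` is a unimodal nonautonomous discrete dynamical system with
turning points `c n`. -/
def IsUNDS (a b : ℝ) (f : ℕ → ℝ → ℝ) (c : ℕ → ℝ) : Prop :=
  a < b ∧ ∀ n : ℕ,
    ContinuousOn (f n) (Icc a b) ∧
    MapsTo (f n) (Icc a b) (Icc a b) ∧
    f n a = a ∧ f n b = a ∧
    c n ∈ Ioo a b ∧
    StrictMonoOn (f n) (Icc a (c n)) ∧
    StrictAntiOn (f n) (Icc (c n) b)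

/-- The two systems have the same kneading sequence. -/
def SameKneading (f : ℕ → ℝ → ℝ) (cF : ℕ → ℝ) (g : ℕ → ℝ → ℝ) (cG : ℕ → ℝ) : Prop :=
  ∀ n ℓ : ℕ,
    (iterFrom f n ℓ (cF n) < cF (n + ℓ) ↔ iterFrom g n ℓ (cG n) < cG (n + ℓ)) ∧
    (iterFrom f n ℓ (cF n) = cF (n + ℓ) ↔ iterFrom g n ℓ (cG n) = cG (n + ℓ))

/-- `𝒞_n(ℱ)`: points of `Icc a b` eventually mapped onto a turning point. -/
def critSet (a b : ℝ) (f : ℕ → ℝ → ℝ) (c : ℕ → ℝ) (n : ℕ) : Set ℝ :=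
  {x ∈ Icc a b | ∃ ℓ : ℕ, iterFrom f n ℓ x = c (n + ℓ)}

/-- A (single) unimodal map on `Icc a b` with turning point `cg`. -/
def IsUnimodal (a b : ℝ) (g : ℝ → ℝ) (cg : ℝ) : Prop :=
  ContinuousOn g (Icc a b) ∧ MapsTo g (Icc a b) (Icc a b) ∧
  g a = a ∧ g b = a ∧ cg ∈ Ioo a b ∧
  StrictMonoOn g (Icc a cg) ∧ StrictAntiOn g (Icc cg b)

/-- `𝒞(g)` for an autonomous unimodal map `g`. -/
def critSetMap (a b : ℝ) (g : ℝ → ℝ) (cg : ℝ) : Set ℝ :=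
  {x ∈ Icc a b | ∃ ℓ : ℕ, g^[ℓ] x = cg}

/-- The limit property for a UNDS. -/
def LimitProperty (a b : ℝ) (f : ℕ → ℝ → ℝ) (c : ℕ → ℝ) : Prop :=
  ∃ (g : ℝ → ℝ) (cg : ℝ),
    IsUnimodal a b g cg ∧
    (∀ m : ℕ, 1 ≤ m → g^[m] cg ≠ cg) ∧
    TendstoUniformlyOn (fun n => f n) g Filter.atTop (Icc a b) ∧
    (∀ n : ℕ, Icc a b ⊆ closure (critSet a b f c n)) ∧
    Icc a b ⊆ closure (critSetMap a b g cg)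

/-- `𝒞_n^k(𝒢)`: points mapped onto a turning point within the first `k` levels. -/
def critSetK (a b : ℝ) (f : ℕ → ℝ → ℝ) (c : ℕ → ℝ) (n k : ℕ) : Set ℝ :=
  {x ∈ Icc a b | ∃ ℓ < k, iterFrom f n ℓ x = c (n + ℓ)}

open Filter Topology

theorem IsUNDS.mapsTo_iterFrom {a b : ℝ} {f : ℕ → ℝ → ℝ} {c : ℕ → ℝ} (h : IsUNDS a b f c)
    (n ℓ : ℕ) : MapsTo (iterFrom f n ℓ) (Icc a b) (Icc a b) := by
  induction ℓ with
  | zero => exact fun x hx => hx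
  | succ ℓ ih => exact fun x hx => (h.2 (n + ℓ)).2.1 (ih hx)

theorem IsUNDS.continuousOn_iterFrom {a b : ℝ} {f : ℕ → ℝ → ℝ} {c : ℕ → ℝ} (h : IsUNDS a b f c)
    (n ℓ : ℕ) : ContinuousOn (iterFrom f n ℓ) (Icc a b) := by
  induction ℓ with
  | zero => exact continuousOn_id
  | succ ℓ ih => exact (h.2 (n + ℓ)).1.comp ih (h.mapsTo_iterFrom n ℓ)

theorem IsUNDS.tendsto_iterFrom {a b : ℝ} {f : ℕ → ℝ → ℝ} {c : ℕ → ℝ} (h : IsUNDS a b f c)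
    {g : ℝ → ℝ} (hg : ContinuousOn g (Icc a b)) (hgm : MapsTo g (Icc a b) (Icc a b))
    (hfg : TendstoUniformlyOn f g atTop (Icc a b)) {x : ℝ} (hx : x ∈ Icc a b) (ℓ : ℕ) :
    Tendsto (fun n => iterFrom f n ℓ x) atTop (𝓝 (g^[ℓ] x)) := by
  induction ℓ with
  | zero => exact tendsto_const_nhds
  | succ ℓ ih =>
    have hmem : g^[ℓ] x ∈ Icc a b := hgm.iterate ℓ hx
    have hshift : TendstoUniformlyOn (fun n => f (n + ℓ)) g atTop (Icc a b) := fun u hu =>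
      (tendsto_add_atTop_nat ℓ).eventually (hfg u hu)
    rw [Function.iterate_succ_apply']
    exact hshift.tendsto_comp (hg _ hmem)
      (tendsto_nhdsWithin_iff.2 ⟨ih, Eventually.of_forall fun n => h.mapsTo_iterFrom n ℓ hx⟩)

/-- Turning points converge to the turning point of the limit map. -/
theorem IsUNDS.tendsto_turningPoint {a b : ℝ} {f : ℕ → ℝ → ℝ} {c : ℕ → ℝ} (h : IsUNDS a b f c)
    {g : ℝ → ℝ} {cg : ℝ} (hg : IsUnimodal a b g cg)
    (hfg : TendstoUniformlyOn f g atTop (Icc a b)) : Tendsto c atTop (𝓝 cg) := by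
  obtain ⟨-, -, -, -, hcg, hmono, hanti⟩ := hg
  have hlim : ∀ x ∈ Icc a b, Tendsto (fun n => f n x) atTop (𝓝 (g x)) :=
    fun x hx => hfg.tendsto_at hx
  have hcgI : cg ∈ Icc a b := Ioo_subset_Icc_self hcg
  refine tendsto_order.2 ⟨fun p hp => ?_, fun q hq => ?_⟩
  · set p' := max a p
    have hp' : p' < cg := max_lt hcg.1 hp
    have hap : a ≤ p' := le_max_left _ _
    have hpI : p' ∈ Icc a b := ⟨hap, hp'.le.trans hcgI.2⟩
    filter_upwards [(hlim p' hpI).eventually_lt (hlim cg hcgI)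
      (hmono ⟨hap, hp'.le⟩ ⟨hcgI.1, le_rfl⟩ hp')] with n hn
    refine (le_max_right a p).trans_lt (lt_of_not_ge fun hc => ?_)
    exact hn.not_gt ((h.2 n).2.2.2.2.2.2 ⟨hc, hpI.2⟩ ⟨hc.trans hp'.le, hcgI.2⟩ hp')
  · set q' := min b q
    have hq' : cg < q' := lt_min hcg.2 hq
    have hqb : q' ≤ b := min_le_left _ _
    have hqI : q' ∈ Icc a b := ⟨hcgI.1.trans hq'.le, hqb⟩
    filter_upwards [(hlim q' hqI).eventually_lt (hlim cg hcgI)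
      (hanti ⟨le_rfl, hcgI.2⟩ ⟨hq'.le, hqb⟩ hq')] with n hn
    refine (lt_of_not_ge fun hc => ?_ : c n < q').trans_le (min_le_right b q)
    exact hn.not_gt ((h.2 n).2.2.2.2.2.1 ⟨hcgI.1, hq'.le.trans hc⟩ ⟨hqI.1, hc⟩ hq')

/-- A unimodal map is injective on a preconnected set avoiding its turning point. -/
theorem IsUnimodal.injOn_of_notMem {a b : ℝ} {g : ℝ → ℝ} {cg : ℝ} (hg : IsUnimodal a b g cg)
    {s : Set ℝ} (hs : IsPreconnected s) (hsub : s ⊆ Icc a b) (hcg : cg ∉ s) : InjOn g s := by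
  obtain ⟨-, -, -, -, -, hmono, hanti⟩ := hg
  intro x hx y hy hxy
  rcases le_total x cg with h1 | h1 <;> rcases le_total y cg with h2 | h2
  · exact hmono.injOn ⟨(hsub hx).1, h1⟩ ⟨(hsub hy).1, h2⟩ hxy
  · exact absurd (hs.ordConnected.out hx hy ⟨h1, h2⟩) hcg
  · exact absurd (hs.ordConnected.out hy hx ⟨h2, h1⟩) hcg
  · exact hanti.injOn ⟨h1, (hsub hx).2⟩ ⟨h2, (hsub hy).2⟩ hxy

/-- An iterate is injective on a preconnected set whose earlier images avoid the turning point. -/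
theorem IsUnimodal.injOn_iterate {a b : ℝ} {g : ℝ → ℝ} {cg : ℝ} (hg : IsUnimodal a b g cg)
    {s : Set ℝ} (hs : IsPreconnected s) (hsub : s ⊆ Icc a b) (ℓ : ℕ)
    (havoid : ∀ i < ℓ, ∀ x ∈ s, g^[i] x ≠ cg) : InjOn g^[ℓ] s := by
  induction ℓ with
  | zero => exact injOn_id s
  | succ ℓ ih =>
    have hcont : ContinuousOn g^[ℓ] s := (hg.1.iterate hg.2.1 ℓ).mono hsub
    rw [Function.iterate_succ']
    refine (hg.injOn_of_notMem (hs.image _ hcont) ?_ ?_).comp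
      (ih fun i hi => havoid i (hi.trans ℓ.lt_succ_self)) (mapsTo_image _ _)
    · exact image_subset_iff.2 fun x hx => hg.2.1.iterate ℓ (hsub hx)
    · rintro ⟨x, hx, hxc⟩
      exact havoid ℓ ℓ.lt_succ_self x hx hxc

/-- If the precritical points are dense, then on every nondegenerate subinterval some iterate
crosses the turning point transversally. -/
theorem IsUnimodal.exists_iterate_lt_lt {a b : ℝ} {g : ℝ → ℝ} {cg : ℝ}
    (hg : IsUnimodal a b g cg) (hdense : Icc a b ⊆ closure (critSetMap a b g cg))
    {u v : ℝ} (huv : u < v) (hsub : Icc u v ⊆ Icc a b) :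
    ∃ ℓ : ℕ, ∃ p ∈ Icc u v, ∃ q ∈ Icc u v, g^[ℓ] p < cg ∧ cg < g^[ℓ] q := by
  classical
  have hex : ∃ ℓ : ℕ, ∃ y ∈ Ioo u v, g^[ℓ] y = cg := by
    obtain ⟨m, hm⟩ := exists_between huv
    obtain ⟨y, hy, -, ℓ, hℓ⟩ := mem_closure_iff.1 (hdense (hsub (Ioo_subset_Icc_self hm)))
      (Ioo u v) isOpen_Ioo hm
    exact ⟨ℓ, y, hy, hℓ⟩
  obtain ⟨y, hy, hyc⟩ := Nat.find_spec hex
  have hinj := hg.injOn_iterate isPreconnected_Ioo (Ioo_subset_Icc_self.trans hsub)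
    (Nat.find hex) fun i hi x hx hxc => Nat.find_min hex hi ⟨x, hx, hxc⟩
  generalize Nat.find hex = ℓ at hyc hinj
  obtain ⟨p, hup, hpy⟩ := exists_between hy.1
  obtain ⟨q, hyq, hqv⟩ := exists_between hy.2
  have hpq : Icc p q ⊆ Ioo u v := Icc_subset_Ioo hup hqv
  have hp : p ∈ Icc p q := ⟨le_rfl, (hpy.trans hyq).le⟩
  have hq : q ∈ Icc p q := ⟨(hpy.trans hyq).le, le_rfl⟩
  have hyI : y ∈ Icc p q := ⟨hpy.le, hyq.le⟩
  have hpuv := Ioo_subset_Icc_self (hpq hp)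
  have hquv := Ioo_subset_Icc_self (hpq hq)
  have hcont : ContinuousOn g^[ℓ] (Icc p q) :=
    (hg.1.iterate hg.2.1 ℓ).mono (hpq.trans (Ioo_subset_Icc_self.trans hsub))
  rcases hcont.strictMonoOn_of_injOn_Icc' (hpy.trans hyq).le (hinj.mono hpq) with hm | hm
  · exact ⟨ℓ, p, hpuv, q, hquv, hyc ▸ hm hp hyI hpy, hyc ▸ hm hyI hq hyq⟩
  · exact ⟨ℓ, q, hquv, p, hpuv, hyc ▸ hm hyI hq hyq, hyc ▸ hm hp hyI hpy⟩

theorem critSetK_mono {a b : ℝ} {f : ℕ → ℝ → ℝ} {c : ℕ → ℝ} {n k k' : ℕ} (h : k ≤ k') :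
    critSetK a b f c n k ⊆ critSetK a b f c n k' :=
  fun _ ⟨hx, ℓ, hℓ, he⟩ => ⟨hx, ℓ, hℓ.trans_le h, he⟩

/-- Every nondegenerate subinterval eventually meets the critical sets of some fixed level. -/
theorem LimitProperty.eventually_inter_critSetK_nonempty {a b : ℝ} {f : ℕ → ℝ → ℝ} {c : ℕ → ℝ}
    (hL : LimitProperty a b f c) (hf : IsUNDS a b f c) {u v : ℝ} (huv : u < v)
    (hsub : Icc u v ⊆ Icc a b) :
    ∃ k : ℕ, ∀ᶠ n in atTop, (Icc u v ∩ critSetK a b f c n k).Nonempty := by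
  obtain ⟨g, cg, hg, -, hfg, -, hdense⟩ := hL
  obtain ⟨ℓ, p, hp, q, hq, hpc, hqc⟩ := hg.exists_iterate_lt_lt hdense huv hsub
  have hc : Tendsto (fun n => c (n + ℓ)) atTop (𝓝 cg) :=
    (hf.tendsto_turningPoint hg hfg).comp (tendsto_add_atTop_nat ℓ)
  refine ⟨ℓ + 1, ?_⟩
  filter_upwards [(hf.tendsto_iterFrom hg.1 hg.2.1 hfg (hsub hp) ℓ).eventually_lt hc hpc,
    hc.eventually_lt (hf.tendsto_iterFrom hg.1 hg.2.1 hfg (hsub hq) ℓ) hqc] with n h1 h2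
  obtain ⟨y, hy, hyc⟩ := isPreconnected_Icc.intermediate_value hp hq
    ((hf.continuousOn_iterFrom n ℓ).mono hsub) ⟨h1.le, h2.le⟩
  exact ⟨y, hy, hsub hy, ℓ, ℓ.lt_succ_self, hyc⟩

/-- For a UNDS with the limit property, for every `ε > 0` there are `k ≥ 1` and `N ≥ 1`
such that for all `n ≥ N` the set `𝒞_n^k(𝒢)` is `ε`-dense in the interval. -/
theorem critSetK_eventually_eps_dense
    (a b : ℝ) (g : ℕ → ℝ → ℝ) (c : ℕ → ℝ)
    (hG : IsUNDS a b g c) (hL : LimitProperty a b g c) :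
    ∀ ε > (0:ℝ), ∃ k : ℕ, 1 ≤ k ∧ ∃ N : ℕ, 1 ≤ N ∧ ∀ n : ℕ, N ≤ n →
      ∀ x ∈ Icc a b, ∃ y ∈ critSetK a b g c n k, |x - y| ≤ ε := by
  intro ε hε
  suffices H : ∃ k : ℕ, ∀ᶠ n in atTop, ∀ x ∈ Icc a b, ∃ y ∈ critSetK a b g c n k, |x - y| ≤ ε by
    obtain ⟨k, hk⟩ := H
    obtain ⟨N, hN⟩ := eventually_atTop.1 hk
    refine ⟨k + 1, k.succ_pos, N + 1, N.succ_pos, fun n hn x hx => ?_⟩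
    obtain ⟨y, hy, hxy⟩ := hN n (N.le_succ.trans hn) x hx
    exact ⟨y, critSetK_mono k.le_succ hy, hxy⟩
  refine isCompact_Icc.induction_on
    (p := fun s => ∃ k : ℕ, ∀ᶠ n in atTop, ∀ x ∈ s, ∃ y ∈ critSetK a b g c n k, |x - y| ≤ ε)
    ⟨0, by simp⟩ ?_ ?_ ?_
  · rintro s t hst ⟨k, hk⟩
    exact ⟨k, hk.mono fun n hn x hx => hn x (hst hx)⟩
  · rintro s t ⟨k, hk⟩ ⟨k', hk'⟩
    refine ⟨max k k', ?_⟩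
    filter_upwards [hk, hk'] with n hs ht
    rintro x (hx | hx)
    · obtain ⟨y, hy, hxy⟩ := hs x hx
      exact ⟨y, critSetK_mono (le_max_left _ _) hy, hxy⟩
    · obtain ⟨y, hy, hxy⟩ := ht x hx
      exact ⟨y, critSetK_mono (le_max_right _ _) hy, hxy⟩
  · intro x hx
    have huv : max a (x - ε / 2) < min b (x + ε / 2) := by
      have h1 := hx.1
      have h2 := hx.2
      have h3 := hG.1
      rw [max_lt_iff, lt_min_iff, lt_min_iff]
      refine ⟨⟨?_, ?_⟩, ?_, ?_⟩ <;> linarith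
    obtain ⟨k, hk⟩ := hL.eventually_inter_critSetK_nonempty hG huv
      (Icc_subset_Icc (le_max_left _ _) (min_le_left _ _))
    refine ⟨Metric.ball x (ε / 2), mem_nhdsWithin_of_mem_nhds (Metric.ball_mem_nhds x (half_pos hε)),
      k, hk.mono ?_⟩
    rintro n ⟨y, hy, hyk⟩ z hz
    refine ⟨y, hyk, ?_⟩
    have h1 := (le_max_right a (x - ε / 2)).trans hy.1
    have h2 := hy.2.trans (min_le_right b (x + ε / 2))
    rw [Metric.mem_ball, Real.dist_eq, abs_lt] at hz
    rw [abs_le]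
    constructor <;> linarith
end
end

section
/- Let (J^ℱ,(f_n)) be a unimodal nonautonomous discrete dynamical system satisfying the limit property. Then for every k≥1 there exist δ>0 and N≥1 such that for all n≥N and any two distinct points x,y∈𝒞_n^k(ℱ), one has |x−y|≥δ. -/
open Set

noncomputable section

open Filter Topology

theorem iterFrom_add (f : ℕ → ℝ → ℝ) (n j i : ℕ) (x : ℝ) :
    iterFrom f n (j + i) x = iterFrom f (n + j) i (iterFrom f n j x) := by
  induction i with
  | zero => rfl
  | succ i ih =>
    change f (n + (j + i)) (iterFrom f n (j + i) x) = f (n + j + i) _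
    rw [ih, add_assoc]

theorem mapsTo_iterFrom {f : ℕ → ℝ → ℝ} {s : Set ℝ} (hf : ∀ n, MapsTo (f n) s s) (n ℓ : ℕ) :
    MapsTo (iterFrom f n ℓ) s s := by
  induction ℓ with
  | zero => exact fun x hx => hx
  | succ ℓ ih => exact fun x hx => hf _ (ih hx)

theorem continuousOn_iterFrom {f : ℕ → ℝ → ℝ} {s : Set ℝ} (hc : ∀ n, ContinuousOn (f n) s)
    (hf : ∀ n, MapsTo (f n) s s) (n ℓ : ℕ) : ContinuousOn (iterFrom f n ℓ) s := by
  induction ℓ with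
  | zero => exact continuousOn_id
  | succ ℓ ih => exact (hc (n + ℓ)).comp ih (mapsTo_iterFrom hf n ℓ)

/-- If the maps `f n` converge uniformly to `g`, then so do their iterates of a fixed length. -/
theorem tendstoUniformlyOn_iterFrom {f : ℕ → ℝ → ℝ} {g : ℝ → ℝ} {s : Set ℝ}
    (hf : ∀ n, MapsTo (f n) s s) (hg : UniformContinuousOn g s) (hgs : MapsTo g s s)
    (h : TendstoUniformlyOn f g atTop s) (ℓ : ℕ) :
    TendstoUniformlyOn (fun n => iterFrom f n ℓ) g^[ℓ] atTop s := by
  induction ℓ with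
  | zero => exact Metric.tendstoUniformlyOn_iff.2 fun ε hε => .of_forall fun _ x _ => (dist_self x).trans_lt hε
  | succ ℓ ih =>
    rw [Metric.tendstoUniformlyOn_iff] at h ih ⊢
    intro ε hε
    obtain ⟨δ, hδ, hgδ⟩ := Metric.uniformContinuousOn_iff.1 hg (ε / 2) (half_pos hε)
    filter_upwards [ih δ hδ, (tendsto_add_atTop_nat ℓ).eventually (h (ε / 2) (half_pos hε))]
      with n hn hn' x hx
    have hm := mapsTo_iterFrom hf n ℓ hx
    rw [Function.iterate_succ_apply']
    calc dist (g (g^[ℓ] x)) (f (n + ℓ) (iterFrom f n ℓ x))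
        ≤ dist (g (g^[ℓ] x)) (g (iterFrom f n ℓ x)) +
          dist (g (iterFrom f n ℓ x)) (f (n + ℓ) (iterFrom f n ℓ x)) := dist_triangle _ _ _
      _ < ε / 2 + ε / 2 := add_lt_add (hgδ _ (hgs.iterate ℓ hx) _ hm (hn x hx)) (hn' _ hm)
      _ = ε := add_halves ε

/-- Maximum points of uniformly convergent functions on a compact set converge to the maximum point
of the limit, when the latter is unique. -/
theorem tendsto_of_isMaxOn {f : ℕ → ℝ → ℝ} {g : ℝ → ℝ} {c : ℕ → ℝ} {m : ℝ} {s : Set ℝ}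
    (hs : IsCompact s) (hg : ContinuousOn g s) (h : TendstoUniformlyOn f g atTop s)
    (hc : ∀ n, c n ∈ s) (hmax : ∀ n, IsMaxOn (f n) s (c n)) (hm : m ∈ s)
    (hlt : ∀ x ∈ s, x ≠ m → g x < g m) : Tendsto c atTop (𝓝 m) := by
  rw [Metric.tendsto_nhds]
  intro ε hε
  rcases (s \ Metric.ball m ε).eq_empty_or_nonempty with he | hne
  · exact .of_forall fun n => sdiff_eq_empty.1 he (hc n)
  obtain ⟨p, hp, hpmax⟩ :=
    (hs.diff Metric.isOpen_ball).exists_isMaxOn hne (hg.mono sdiff_subset)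
  have hpm : g p < g m := hlt p hp.1 fun e => hp.2 (e ▸ Metric.mem_ball_self hε)
  filter_upwards [Metric.tendstoUniformlyOn_iff.1 h ((g m - g p) / 2) (by linarith)] with n hn
  by_contra hfar
  have h₁ : g (c n) ≤ g p := hpmax ⟨hc n, hfar⟩
  have h₂ : f n m ≤ f n (c n) := hmax n hm
  have h₃ := abs_lt.1 (hn m hm)
  have h₄ := abs_lt.1 (hn (c n) (hc n))
  linarith [h₃.2, h₄.1]

theorem lt_of_ne_turningPoint {a b m x : ℝ} {g : ℝ → ℝ} (hm : m ∈ Ioo a b)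
    (hl : StrictMonoOn g (Icc a m)) (hr : StrictAntiOn g (Icc m b)) (hx : x ∈ Icc a b)
    (hne : x ≠ m) : g x < g m := by
  rcases hne.lt_or_gt with h | h
  · exact hl ⟨hx.1, h.le⟩ (right_mem_Icc.2 hm.1.le) h
  · exact hr (left_mem_Icc.2 hm.2.le) ⟨h.le, hx.2⟩ h

theorem turningPoint_mem_uIcc {a b m u v : ℝ} {g : ℝ → ℝ}
    (hl : StrictMonoOn g (Icc a m)) (hr : StrictAntiOn g (Icc m b)) (hu : u ∈ Icc a b)
    (hv : v ∈ Icc a b) (hne : u ≠ v) (h : g u = g v) : m ∈ uIcc u v := by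
  rw [mem_uIcc]
  by_contra! hm
  rcases le_total u m with hum | hum <;> rcases le_total v m with hvm | hvm
  · exact hne (hl.injOn ⟨hu.1, hum⟩ ⟨hv.1, hvm⟩ h)
  · exact absurd hvm (hm.1 hum).not_ge
  · exact absurd hum (hm.2 hvm).not_ge
  · exact hne (hr.injOn ⟨hum, hu.2⟩ ⟨hvm, hv.2⟩ h)

/-- Between two distinct points with the same image under `f_n^ℓ` there is a point that reaches a
turning point in fewer than `ℓ` steps. -/
theorem exists_iterFrom_eq_turningPoint {a b : ℝ} {f : ℕ → ℝ → ℝ} {c : ℕ → ℝ}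
    (hF : IsUNDS a b f c) {n ℓ : ℕ} {x y : ℝ} (hx : x ∈ Icc a b) (hy : y ∈ Icc a b)
    (hne : x ≠ y) (h : iterFrom f n ℓ x = iterFrom f n ℓ y) :
    ∃ j < ℓ, ∃ w ∈ uIcc x y, iterFrom f n j w = c (n + j) := by
  induction ℓ with
  | zero => exact absurd h hne
  | succ ℓ ih =>
    by_cases he : iterFrom f n ℓ x = iterFrom f n ℓ y
    · obtain ⟨j, hj, hw⟩ := ih he
      exact ⟨j, hj.trans ℓ.lt_succ_self, hw⟩
    have hmaps := mapsTo_iterFrom (fun n => (hF.2 n).2.1) n ℓ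
    obtain ⟨-, -, -, -, -, hl, hr⟩ := hF.2 (n + ℓ)
    have hcont : ContinuousOn (iterFrom f n ℓ) (uIcc x y) :=
      (continuousOn_iterFrom (fun n => (hF.2 n).1) (fun n => (hF.2 n).2.1) n ℓ).mono
        (ordConnected_Icc.uIcc_subset hx hy)
    obtain ⟨w, hw, hwc⟩ := intermediate_value_uIcc hcont
      (turningPoint_mem_uIcc hl hr (hmaps hx) (hmaps hy) he h)
    exact ⟨ℓ, ℓ.lt_succ_self, w, hw, hwc⟩

/-- Points reaching a turning point after `j` and after `ℓ > j` steps are uniformly separated. -/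
theorem exists_separation_of_lt {a b : ℝ} {f : ℕ → ℝ → ℝ} {c : ℕ → ℝ}
    (hF : IsUNDS a b f c) (hL : LimitProperty a b f c) {j ℓ : ℕ} (hj : j < ℓ) :
    ∃ δ > (0 : ℝ), ∀ᶠ n in atTop, ∀ x ∈ Icc a b, ∀ w ∈ Icc a b,
      iterFrom f n ℓ x = c (n + ℓ) → iterFrom f n j w = c (n + j) → δ ≤ |x - w| := by
  obtain ⟨g, m, ⟨hg, hgm, -, -, hm, hl, hr⟩, hper, hlim, -, -⟩ := hL
  have hmaps n : MapsTo (f n) (Icc a b) (Icc a b) := (hF.2 n).2.1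
  have hcI n : c n ∈ Icc a b := Ioo_subset_Icc_self (hF.2 n).2.2.2.2.1
  have hmI : m ∈ Icc a b := Ioo_subset_Icc_self hm
  have hc : Tendsto c atTop (𝓝 m) := by
    refine tendsto_of_isMaxOn isCompact_Icc hg hlim hcI (fun n x hx => ?_) hmI
      fun x hx => lt_of_ne_turningPoint hm hl hr hx
    obtain ⟨-, -, -, -, hcn, hln, hrn⟩ := hF.2 n
    rcases eq_or_ne x (c n) with hxc | hne
    · exact (congrArg (f n) hxc).le
    · exact (lt_of_ne_turningPoint hcn hln hrn hx hne).le
  have hunif := tendstoUniformlyOn_iterFrom hmaps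
    (isCompact_Icc.uniformContinuousOn_of_continuous hg) hgm hlim
  have hgcont i : ContinuousOn g^[i] (Icc a b) := hg.iterate hgm i
  obtain ⟨i, hi, rfl⟩ : ∃ i, 1 ≤ i ∧ ℓ = j + i := ⟨ℓ - j, by omega, by omega⟩
  have hci : Tendsto (fun n => iterFrom f n i (c n)) atTop (𝓝 (g^[i] m)) :=
    (hunif i).tendsto_comp (hgcont i m hmI)
      (tendsto_nhdsWithin_iff.2 ⟨hc, .of_forall hcI⟩)
  have hdist := (hci.comp (tendsto_add_atTop_nat j)).dist
    (hc.comp (tendsto_add_atTop_nat (j + i)))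
  set ε := dist (g^[i] m) m
  have hε : 0 < ε := dist_pos.2 (hper i hi)
  obtain ⟨δ, hδ, hgδ⟩ := Metric.uniformContinuousOn_iff.1
    (isCompact_Icc.uniformContinuousOn_of_continuous (hgcont (j + i))) (ε / 4) (by linarith)
  refine ⟨δ, hδ, ?_⟩
  filter_upwards [hdist.eventually (lt_mem_nhds (show 3 * ε / 4 < ε by linarith)),
    Metric.tendstoUniformlyOn_iff.1 (hunif (j + i)) (ε / 4) (by linarith)]
    with n hn hn' x hx w hw hxc hwc
  by_contra! hlt
  have h₁ := hgδ w hw x hx (by rwa [dist_comm, Real.dist_eq])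
  have h₂ := hn' w hw
  have h₃ := hn' x hx
  rw [iterFrom_add, hwc, dist_comm] at h₂
  rw [hxc] at h₃
  simp only [Function.comp_apply] at hn
  linarith [dist_triangle4 (iterFrom f (n + j) i (c (n + j))) (g^[j + i] w) (g^[j + i] x)
    (c (n + (j + i)))]

/-- For a UNDS with the limit property, for every `k ≥ 1` there are `δ > 0` and `N ≥ 1`
such that for all `n ≥ N` any two distinct points of `𝒞_n^k(ℱ)` are at distance
at least `δ`. -/
theorem critSetK_eventually_separated
    (a b : ℝ) (f : ℕ → ℝ → ℝ) (c : ℕ → ℝ)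
    (hF : IsUNDS a b f c) (hL : LimitProperty a b f c) :
    ∀ k : ℕ, 1 ≤ k → ∃ δ > (0:ℝ), ∃ N : ℕ, 1 ≤ N ∧ ∀ n : ℕ, N ≤ n →
      ∀ x ∈ critSetK a b f c n k, ∀ y ∈ critSetK a b f c n k, x ≠ y → δ ≤ |x - y| := by
  intro k _
  have hsep : ∀ᶠ δ in 𝓝[>] (0 : ℝ), ∀ ℓ ∈ Finset.range k, ∀ j ∈ Finset.range ℓ,
      ∀ᶠ n in atTop, ∀ x ∈ Icc a b, ∀ w ∈ Icc a b,
        iterFrom f n ℓ x = c (n + ℓ) → iterFrom f n j w = c (n + j) → δ ≤ |x - w| := by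
    simp only [Filter.eventually_all_finset]
    intro ℓ _ j hj
    obtain ⟨δ₀, hδ₀, h⟩ := exists_separation_of_lt hF hL (Finset.mem_range.1 hj)
    filter_upwards [Ioo_mem_nhdsGT hδ₀] with δ hδ
    filter_upwards [h] with n hn x hx w hw hxc hwc
    exact hδ.2.le.trans (hn x hx w hw hxc hwc)
  obtain ⟨δ, hδ, hδ0⟩ := (hsep.and self_mem_nhdsWithin).exists
  simp only [← Filter.eventually_all_finset] at hδ
  simp only [Finset.mem_range] at hδ
  obtain ⟨N, hN⟩ := eventually_atTop.1 hδ
  refine ⟨δ, hδ0, N + 1, by omega, ?_⟩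
  rintro n hn x ⟨hx, ℓ, hℓ, hxc⟩ y ⟨hy, p, hp, hyc⟩ hne
  have key := hN n (by omega)
  rcases lt_trichotomy ℓ p with hlt | rfl | hlt
  · rw [abs_sub_comm]
    exact key p hp ℓ hlt y hy x hx hyc hxc
  · obtain ⟨j, hj, w, hw, hwc⟩ :=
      exists_iterFrom_eq_turningPoint hF hx hy hne (hxc.trans hyc.symm)
    have hxw := key ℓ hℓ j hj x hx w (ordConnected_Icc.uIcc_subset hx hy hw) hxc hwc
    rw [abs_sub_comm x w] at hxw
    rw [abs_sub_comm x y]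
    exact hxw.trans (abs_sub_left_of_mem_uIcc hw)
  · exact key ℓ hℓ p hlt x hx y hy hxc hyc
end
end

section
/- For n≥1 define f_n,g_n:[0,1]→[0,1] by f_n(x)=((2n+4)/(4+n))·x for x∈[0,(4+n)/(2n+4)] and f_n(x)=((2n+4)/n)·(1−x) for x∈[(4+n)/(2n+4),1], and g_n(x)=((4n+4)/(3n−1))·x for x∈[0,(3n−1)/(4n+4)] and g_n(x)=((4n+4)/(n+5))·(1−x) for x∈[(3n−1)/(4n+4),1]. Then the nonautonomous systems ([0,1],(f_n)_{n≥1}) and ([0,1],(g_n)_{n≥1}) are topologically conjugate. -/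
open Set

noncomputable section

/-- `f_n(x) = ((2n+4)/(4+n))·x` on `[0,(4+n)/(2n+4)]` and
`f_n(x) = ((2n+4)/n)·(1-x)` on `[(4+n)/(2n+4),1]`. -/
def fEx (n : ℕ) (x : ℝ) : ℝ :=
  if x ≤ (4 + (n : ℝ)) / (2 * n + 4) then ((2 * (n : ℝ) + 4) / (4 + n)) * x
  else ((2 * (n : ℝ) + 4) / n) * (1 - x)

/-- `g_n(x) = ((4n+4)/(3n-1))·x` on `[0,(3n-1)/(4n+4)]` and
`g_n(x) = ((4n+4)/(n+5))·(1-x)` on `[(3n-1)/(4n+4),1]`. -/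
def gEx (n : ℕ) (x : ℝ) : ℝ :=
  if x ≤ (3 * (n : ℝ) - 1) / (4 * n + 4) then ((4 * (n : ℝ) + 4) / (3 * n - 1)) * x
  else ((4 * (n : ℝ) + 4) / (n + 5)) * (1 - x)

open Filter Topology

/-- The full tent map of `[0,1]` with turning point `a`. -/
def tent (a x : ℝ) : ℝ := if x ≤ a then x / a else (1 - x) / (1 - a)

/-- The lift of `u` through the tent maps with turning points `a` and `b`: the increasing solution
`v` of `u ∘ tent a = tent b ∘ v`. -/
def tentLift (a b : ℝ) (u : ℝ → ℝ) (x : ℝ) : ℝ :=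
  if x ≤ a then b * u (x / a) else 1 - (1 - b) * u ((1 - x) / (1 - a))

/-- The `k`-th approximation, starting from the identity, to the conjugacy between the sequences of
tent maps with turning points `c` and `d`. -/
def conjApprox (c d : ℕ → ℝ) : ℕ → ℕ → ℝ → ℝ
  | 0, _ => id
  | k + 1, n => tentLift (c n) (d n) (conjApprox c d k (n + 1))

/-- The conjugacy between the sequences of tent maps with turning points `c` and `d`. -/
def tentConj (c d : ℕ → ℝ) (n : ℕ) (x : ℝ) : ℝ :=
  limUnder atTop fun k => conjApprox c d k n x

/-- A map of `[0,1]` to itself fixing both endpoints. -/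
structure FixesEndpoints (u : ℝ → ℝ) : Prop where
  mapsTo : MapsTo u (Icc 0 1) (Icc 0 1)
  map_zero : u 0 = 0
  map_one : u 1 = 1

section TentLift

variable {a b x y : ℝ} {u v : ℝ → ℝ}

lemma div_mem_unit (ha : 0 < a) (hx : 0 ≤ x) (hxa : x ≤ a) : x / a ∈ Icc (0 : ℝ) 1 :=
  ⟨by positivity, (div_le_one ha).2 hxa⟩

lemma one_sub_div_mem_unit (ha : a < 1) (hx : x ≤ 1) (hax : a ≤ x) :
    (1 - x) / (1 - a) ∈ Icc (0 : ℝ) 1 :=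
  div_mem_unit (by linarith) (by linarith) (by linarith)

lemma tent_of_ge (ha : a ∈ Ioo (0 : ℝ) 1) (hx : a ≤ x) : tent a x = (1 - x) / (1 - a) := by
  rcases hx.eq_or_lt with rfl | h
  · rw [tent, if_pos le_rfl, div_self ha.1.ne', div_self (by linarith [ha.2])]
  · rw [tent, if_neg h.not_ge]

lemma tentLift_of_ge (ha : a ∈ Ioo (0 : ℝ) 1) (hu : u 1 = 1) (hx : a ≤ x) :
    tentLift a b u x = 1 - (1 - b) * u ((1 - x) / (1 - a)) := by
  rcases hx.eq_or_lt with rfl | h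
  · rw [tentLift, if_pos le_rfl, div_self ha.1.ne', div_self (by linarith [ha.2]), hu]
    ring
  · rw [tentLift, if_neg h.not_ge]

lemma tentLift_left_mem (ha : a ∈ Ioo (0 : ℝ) 1) (hb : b ∈ Ioo (0 : ℝ) 1) (hu : FixesEndpoints u)
    (hx : 0 ≤ x) (hxa : x ≤ a) : tentLift a b u x ∈ Icc 0 b := by
  rw [tentLift, if_pos hxa]
  obtain ⟨h0, h1⟩ := hu.mapsTo (div_mem_unit ha.1 hx hxa)
  exact ⟨mul_nonneg hb.1.le h0, mul_le_of_le_one_right hb.1.le h1⟩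

lemma tentLift_right_mem (ha : a ∈ Ioo (0 : ℝ) 1) (hb : b ∈ Ioo (0 : ℝ) 1) (hu : FixesEndpoints u)
    (hx : x ≤ 1) (hax : a ≤ x) : tentLift a b u x ∈ Icc b 1 := by
  rw [tentLift_of_ge ha hu.map_one hax]
  obtain ⟨h0, h1⟩ := hu.mapsTo (one_sub_div_mem_unit ha.2 hx hax)
  have hb' : 0 ≤ 1 - b := by linarith [hb.2]
  exact ⟨by linarith [mul_le_of_le_one_right hb' h1], by linarith [mul_nonneg hb' h0]⟩

lemma FixesEndpoints.tentLift (hu : FixesEndpoints u) (ha : a ∈ Ioo (0 : ℝ) 1)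
    (hb : b ∈ Ioo (0 : ℝ) 1) : FixesEndpoints (tentLift a b u) where
  mapsTo x hx := by
    rcases le_total x a with h | h
    · exact Icc_subset_Icc_right hb.2.le (tentLift_left_mem ha hb hu hx.1 h)
    · exact Icc_subset_Icc_left hb.1.le (tentLift_right_mem ha hb hu hx.2 h)
  map_zero := by simp [_root_.tentLift, ha.1.le, hu.map_zero]
  map_one := by simp [_root_.tentLift, ha.2.not_ge, hu.map_zero]

lemma tent_tentLift (ha : a ∈ Ioo (0 : ℝ) 1) (hb : b ∈ Ioo (0 : ℝ) 1) (hu : FixesEndpoints u)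
    (hx : x ∈ Icc (0 : ℝ) 1) : tent b (tentLift a b u x) = u (tent a x) := by
  rcases le_total x a with h | h
  · rw [tent, if_pos (tentLift_left_mem ha hb hu hx.1 h).2, tentLift, if_pos h, tent, if_pos h,
      mul_div_cancel_left₀ _ hb.1.ne']
  · rw [tent_of_ge hb (tentLift_right_mem ha hb hu hx.2 h).1, tentLift_of_ge ha hu.map_one h,
      tent_of_ge ha h, sub_sub_cancel, mul_div_cancel_left₀ _ (by linarith [hb.2])]

lemma MonotoneOn.tentLift (hm : MonotoneOn u (Icc 0 1)) (hu : FixesEndpoints u)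
    (ha : a ∈ Ioo (0 : ℝ) 1) (hb : b ∈ Ioo (0 : ℝ) 1) :
    MonotoneOn (tentLift a b u) (Icc 0 1) := by
  intro x hx y hy hxy
  have ha0 := ha.1
  have ha1 : 0 < 1 - a := by linarith [ha.2]
  rcases le_total y a with hya | hya
  · rw [_root_.tentLift, if_pos (hxy.trans hya), _root_.tentLift, if_pos hya]
    exact mul_le_mul_of_nonneg_left (hm (div_mem_unit ha.1 hx.1 (hxy.trans hya))
      (div_mem_unit ha.1 hy.1 hya) (by gcongr)) hb.1.le
  · rcases le_total x a with hxa | hxa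
    · exact (tentLift_left_mem ha hb hu hx.1 hxa).2.trans (tentLift_right_mem ha hb hu hy.2 hya).1
    · rw [tentLift_of_ge ha hu.map_one hxa, tentLift_of_ge ha hu.map_one hya]
      exact sub_le_sub_left (mul_le_mul_of_nonneg_left
        (hm (one_sub_div_mem_unit ha.2 hy.2 hya) (one_sub_div_mem_unit ha.2 hx.2 hxa)
          (by gcongr)) (by linarith [hb.2])) _

/-- Lifting contracts the uniform distance by the factor `max b (1 - b)`. -/
lemma abs_tentLift_sub_le {r C : ℝ} (ha : a ∈ Ioo (0 : ℝ) 1) (hb : b ∈ Ioo (0 : ℝ) 1)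
    (hbr : b ≤ r) (hbr' : 1 - b ≤ r) (h : ∀ z ∈ Icc (0 : ℝ) 1, |u z - v z| ≤ C)
    (hx : x ∈ Icc (0 : ℝ) 1) : |tentLift a b u x - tentLift a b v x| ≤ r * C := by
  have hb1 : 0 ≤ 1 - b := by linarith [hb.2]
  by_cases hxa : x ≤ a
  · simp only [tentLift, if_pos hxa]
    rw [← mul_sub, abs_mul, abs_of_pos hb.1]
    exact mul_le_mul hbr (h _ (div_mem_unit ha.1 hx.1 hxa)) (abs_nonneg _) (hb.1.le.trans hbr)
  · simp only [tentLift, if_neg hxa]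
    rw [sub_sub_sub_cancel_left, ← mul_sub, abs_mul, abs_of_nonneg hb1, abs_sub_comm]
    exact mul_le_mul hbr' (h _ (one_sub_div_mem_unit ha.2 hx.2 (le_of_not_ge hxa)))
      (abs_nonneg _) (hb1.trans hbr')

lemma tentLift_sub_le {L M : ℝ} (ha : a ∈ Ioo (0 : ℝ) 1) (hb : b ∈ Ioo (0 : ℝ) 1)
    (hL : 0 ≤ L) (hM : b ≤ M * a) (hM' : 1 - b ≤ M * (1 - a)) (hu : u 1 = 1)
    (h : ∀ z ∈ Icc (0 : ℝ) 1, ∀ w ∈ Icc (0 : ℝ) 1, z ≤ w → u w - u z ≤ L * (w - z))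
    (hx : x ∈ Icc (0 : ℝ) 1) (hy : y ∈ Icc (0 : ℝ) 1) (hxy : x ≤ y) :
    tentLift a b u y - tentLift a b u x ≤ M * L * (y - x) := by
  have ha0 := ha.1
  have ha1 : 0 < 1 - a := by linarith [ha.2]
  have hb1 : 0 ≤ 1 - b := by linarith [hb.2]
  have left : ∀ z w, 0 ≤ z → z ≤ w → w ≤ a →
      tentLift a b u w - tentLift a b u z ≤ M * L * (w - z) := by
    intro z w hz hzw hw
    rw [tentLift, if_pos hw, tentLift, if_pos (hzw.trans hw), ← mul_sub]
    calc b * (u (w / a) - u (z / a)) ≤ b * (L * (w / a - z / a)) := by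
          refine mul_le_mul_of_nonneg_left (h _ (div_mem_unit ha0 hz (hzw.trans hw)) _
            (div_mem_unit ha0 (hz.trans hzw) hw) (by gcongr)) hb.1.le
      _ ≤ M * a * (L * (w / a - z / a)) := by
          refine mul_le_mul_of_nonneg_right hM (mul_nonneg hL ?_)
          rw [← sub_div]
          exact div_nonneg (by linarith) ha0.le
      _ = M * L * (w - z) := by field_simp
  have right : ∀ z w, a ≤ z → z ≤ w → w ≤ 1 →
      tentLift a b u w - tentLift a b u z ≤ M * L * (w - z) := by
    intro z w hz hzw hw
    rw [tentLift_of_ge ha hu hz, tentLift_of_ge ha hu (hz.trans hzw), sub_sub_sub_cancel_left,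
      ← mul_sub]
    calc (1 - b) * (u ((1 - z) / (1 - a)) - u ((1 - w) / (1 - a)))
        ≤ (1 - b) * (L * ((1 - z) / (1 - a) - (1 - w) / (1 - a))) := by
          refine mul_le_mul_of_nonneg_left (h _ (one_sub_div_mem_unit ha.2 hw (hz.trans hzw)) _
            (one_sub_div_mem_unit ha.2 (hzw.trans hw) hz) (by gcongr)) hb1
      _ ≤ M * (1 - a) * (L * ((1 - z) / (1 - a) - (1 - w) / (1 - a))) := by
          refine mul_le_mul_of_nonneg_right hM' (mul_nonneg hL ?_)
          rw [← sub_div]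
          exact div_nonneg (by linarith) ha1.le
      _ = M * L * (w - z) := by
          field_simp
          ring
  rcases le_total y a with hya | hya
  · exact left x y hx.1 hxy hya
  · rcases le_total x a with hxa | hxa
    · linarith [left x a hx.1 hxa le_rfl, right a y le_rfl hya hy.2]
    · exact right x y hxa hxy hy.2

/-- Lifts through interchanged tent maps compose to a lift. -/
lemma tentLift_tentLift (ha : a ∈ Ioo (0 : ℝ) 1) (hb : b ∈ Ioo (0 : ℝ) 1)
    (hu : FixesEndpoints u) (hv : FixesEndpoints v) (hx : x ∈ Icc (0 : ℝ) 1) :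
    tentLift b a v (tentLift a b u x) = tentLift a a (v ∘ u) x := by
  rcases le_total x a with h | h
  · rw [tentLift, if_pos (tentLift_left_mem ha hb hu hx.1 h).2, tentLift, if_pos h, tentLift,
      if_pos h, mul_div_cancel_left₀ _ hb.1.ne', Function.comp_apply]
  · rw [tentLift_of_ge hb hv.map_one (tentLift_right_mem ha hb hu hx.2 h).1,
      tentLift_of_ge ha hu.map_one h, tentLift_of_ge ha (by simp [hu.map_one, hv.map_one]) h,
      sub_sub_cancel, mul_div_cancel_left₀ _ (by linarith [hb.2]), Function.comp_apply]

lemma tentLift_id (ha : a ∈ Ioo (0 : ℝ) 1) (x : ℝ) : tentLift a a id x = x := by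
  have h0 := ha.1.ne'
  have h1 : 1 - a ≠ 0 := by linarith [ha.2]
  unfold tentLift
  split_ifs
  · rw [id, mul_div_cancel₀ _ h0]
  · rw [id, mul_div_cancel₀ _ h1, sub_sub_cancel]

end TentLift

section TentConj

variable {c d : ℕ → ℝ} {x y : ℝ}

lemma mem_Ioo_of_mem_Icc {a : ℝ} (ha : a ∈ Icc (1 / 6 : ℝ) (5 / 6)) : a ∈ Ioo (0 : ℝ) 1 :=
  ⟨by linarith [ha.1], by linarith [ha.2]⟩

lemma conjApprox_fixesEndpoints (hc : ∀ n, c n ∈ Icc (1 / 6 : ℝ) (5 / 6))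
    (hd : ∀ n, d n ∈ Icc (1 / 6 : ℝ) (5 / 6)) (k n : ℕ) :
    FixesEndpoints (conjApprox c d k n) := by
  induction k generalizing n with
  | zero => exact ⟨fun _ hx => hx, rfl, rfl⟩
  | succ k ih =>
    exact (ih (n + 1)).tentLift (mem_Ioo_of_mem_Icc (hc n)) (mem_Ioo_of_mem_Icc (hd n))

lemma conjApprox_monotoneOn (hc : ∀ n, c n ∈ Icc (1 / 6 : ℝ) (5 / 6))
    (hd : ∀ n, d n ∈ Icc (1 / 6 : ℝ) (5 / 6)) (k n : ℕ) :
    MonotoneOn (conjApprox c d k n) (Icc 0 1) := by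
  induction k generalizing n with
  | zero => exact monotoneOn_id
  | succ k ih =>
    exact (ih (n + 1)).tentLift (conjApprox_fixesEndpoints hc hd k (n + 1))
      (mem_Ioo_of_mem_Icc (hc n)) (mem_Ioo_of_mem_Icc (hd n))

lemma conjApprox_sub_le (hc : ∀ n, c n ∈ Icc (1 / 6 : ℝ) (5 / 6))
    (hd : ∀ n, d n ∈ Icc (1 / 6 : ℝ) (5 / 6)) (k n : ℕ) (hx : x ∈ Icc (0 : ℝ) 1)
    (hy : y ∈ Icc (0 : ℝ) 1) (hxy : x ≤ y) :
    conjApprox c d k n y - conjApprox c d k n x ≤ 5 ^ k * (y - x) := by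
  induction k generalizing n x y with
  | zero => simp [conjApprox]
  | succ k ih =>
    rw [pow_succ']
    exact tentLift_sub_le (mem_Ioo_of_mem_Icc (hc n)) (mem_Ioo_of_mem_Icc (hd n)) (by positivity)
      (by linarith [(hc n).1, (hd n).2]) (by linarith [(hc n).2, (hd n).1])
      (conjApprox_fixesEndpoints hc hd k (n + 1)).map_one
      (fun z hz w hw hzw => ih (n + 1) hz hw hzw) hx hy hxy

lemma abs_conjApprox_sub_succ_le (hc : ∀ n, c n ∈ Icc (1 / 6 : ℝ) (5 / 6))
    (hd : ∀ n, d n ∈ Icc (1 / 6 : ℝ) (5 / 6)) (k n : ℕ) (hx : x ∈ Icc (0 : ℝ) 1) :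
    |conjApprox c d k n x - conjApprox c d (k + 1) n x| ≤ (5 / 6) ^ k := by
  induction k generalizing n x with
  | zero =>
    obtain ⟨h0, h1⟩ := (conjApprox_fixesEndpoints hc hd 0 n).mapsTo hx
    obtain ⟨h2, h3⟩ := (conjApprox_fixesEndpoints hc hd 1 n).mapsTo hx
    rw [pow_zero, abs_le]
    constructor <;> linarith
  | succ k ih =>
    rw [pow_succ']
    exact abs_tentLift_sub_le (mem_Ioo_of_mem_Icc (hc n)) (mem_Ioo_of_mem_Icc (hd n)) (hd n).2
      (by linarith [(hd n).1]) (fun z hz => ih (n + 1) hz) hx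

lemma tendsto_conjApprox (hc : ∀ n, c n ∈ Icc (1 / 6 : ℝ) (5 / 6))
    (hd : ∀ n, d n ∈ Icc (1 / 6 : ℝ) (5 / 6)) (n : ℕ) (hx : x ∈ Icc (0 : ℝ) 1) :
    Tendsto (fun k => conjApprox c d k n x) atTop (𝓝 (tentConj c d n x)) :=
  (cauchySeq_of_le_geometric (5 / 6) 1 (by norm_num) fun k => by
    rw [one_mul, Real.dist_eq]
    exact abs_conjApprox_sub_succ_le hc hd k n hx).tendsto_limUnder

lemma abs_conjApprox_sub_tentConj_le (hc : ∀ n, c n ∈ Icc (1 / 6 : ℝ) (5 / 6))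
    (hd : ∀ n, d n ∈ Icc (1 / 6 : ℝ) (5 / 6)) (k n : ℕ) (hx : x ∈ Icc (0 : ℝ) 1) :
    |conjApprox c d k n x - tentConj c d n x| ≤ 6 * (5 / 6) ^ k := by
  have h := dist_le_of_le_geometric_of_tendsto (5 / 6 : ℝ) 1 (by norm_num) (fun k => by
    rw [one_mul, Real.dist_eq]
    exact abs_conjApprox_sub_succ_le hc hd k n hx) (tendsto_conjApprox hc hd n hx) k
  rw [Real.dist_eq] at h
  convert h using 1
  ring

lemma tentConj_fixesEndpoints (hc : ∀ n, c n ∈ Icc (1 / 6 : ℝ) (5 / 6))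
    (hd : ∀ n, d n ∈ Icc (1 / 6 : ℝ) (5 / 6)) (n : ℕ) : FixesEndpoints (tentConj c d n) where
  mapsTo _ hx := isClosed_Icc.mem_of_tendsto (tendsto_conjApprox hc hd n hx)
    (Eventually.of_forall fun k => (conjApprox_fixesEndpoints hc hd k n).mapsTo hx)
  map_zero := tendsto_nhds_unique (tendsto_conjApprox hc hd n (by simp))
    (by simp [(conjApprox_fixesEndpoints hc hd _ n).map_zero])
  map_one := tendsto_nhds_unique (tendsto_conjApprox hc hd n (by simp))
    (by simp [(conjApprox_fixesEndpoints hc hd _ n).map_one])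

lemma tentConj_monotoneOn (hc : ∀ n, c n ∈ Icc (1 / 6 : ℝ) (5 / 6))
    (hd : ∀ n, d n ∈ Icc (1 / 6 : ℝ) (5 / 6)) (n : ℕ) :
    MonotoneOn (tentConj c d n) (Icc 0 1) := fun _ hx _ hy hxy =>
  le_of_tendsto_of_tendsto' (tendsto_conjApprox hc hd n hx) (tendsto_conjApprox hc hd n hy)
    fun k => conjApprox_monotoneOn hc hd k n hx hy hxy

lemma tentConj_eq_tentLift (hc : ∀ n, c n ∈ Icc (1 / 6 : ℝ) (5 / 6))
    (hd : ∀ n, d n ∈ Icc (1 / 6 : ℝ) (5 / 6)) (n : ℕ) (hx : x ∈ Icc (0 : ℝ) 1) :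
    tentConj c d n x = tentLift (c n) (d n) (tentConj c d (n + 1)) x := by
  have ha := mem_Ioo_of_mem_Icc (hc n)
  refine tendsto_nhds_unique
    ((tendsto_conjApprox hc hd n hx).comp (tendsto_add_atTop_nat 1)) ?_
  simp only [Function.comp_def, conjApprox, tentLift]
  split_ifs with h
  · exact (tendsto_conjApprox hc hd (n + 1) (div_mem_unit ha.1 hx.1 h)).const_mul _
  · exact ((tendsto_conjApprox hc hd (n + 1)
      (one_sub_div_mem_unit ha.2 hx.2 (le_of_not_ge h))).const_mul _).const_sub _

lemma tentConj_leftInvOn (hc : ∀ n, c n ∈ Icc (1 / 6 : ℝ) (5 / 6))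
    (hd : ∀ n, d n ∈ Icc (1 / 6 : ℝ) (5 / 6)) (n : ℕ) :
    LeftInvOn (tentConj d c n) (tentConj c d n) (Icc 0 1) := by
  have key : ∀ k n : ℕ, ∀ x ∈ Icc (0 : ℝ) 1,
      |(tentConj d c n ∘ tentConj c d n) x - id x| ≤ (5 / 6) ^ k := by
    intro k
    induction k with
    | zero =>
      intro n x hx
      obtain ⟨h0, h1⟩ := (tentConj_fixesEndpoints hd hc n).mapsTo
        ((tentConj_fixesEndpoints hc hd n).mapsTo hx)
      rw [pow_zero, Function.comp_apply, id, abs_le]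
      constructor <;> linarith [hx.1, hx.2]
    | succ k ih =>
      intro n x hx
      have ha := mem_Ioo_of_mem_Icc (hc n)
      have hu := tentConj_fixesEndpoints hc hd
      rw [Function.comp_apply, tentConj_eq_tentLift hd hc n ((hu n).mapsTo hx),
        tentConj_eq_tentLift hc hd n hx, tentLift_tentLift ha (mem_Ioo_of_mem_Icc (hd n))
          (hu (n + 1)) (tentConj_fixesEndpoints hd hc (n + 1)) hx, id, pow_succ']
      nth_rewrite 2 [← tentLift_id ha x]
      exact abs_tentLift_sub_le ha ha (hc n).2 (by linarith [(hc n).1]) (ih (n + 1)) hx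
  intro x hx
  have h : |(tentConj d c n ∘ tentConj c d n) x - id x| ≤ 0 :=
    ge_of_tendsto' (tendsto_pow_atTop_nhds_zero_of_lt_one (by norm_num) (by norm_num))
      fun k => key k n x hx
  exact sub_eq_zero.1 (abs_nonpos_iff.1 h)

lemma tentConj_equicontinuous (hc : ∀ n, c n ∈ Icc (1 / 6 : ℝ) (5 / 6))
    (hd : ∀ n, d n ∈ Icc (1 / 6 : ℝ) (5 / 6)) {ε : ℝ} (hε : 0 < ε) :
    ∃ δ > (0 : ℝ), ∀ n, ∀ x ∈ Icc (0 : ℝ) 1, ∀ y ∈ Icc (0 : ℝ) 1, |x - y| < δ →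
      |tentConj c d n x - tentConj c d n y| < ε := by
  obtain ⟨k, hk⟩ := exists_pow_lt_of_lt_one (show 0 < ε / 24 by positivity)
    (show (5 / 6 : ℝ) < 1 by norm_num)
  refine ⟨ε / 2 / 5 ^ k, by positivity, fun n => ?_⟩
  have key : ∀ x ∈ Icc (0 : ℝ) 1, ∀ y ∈ Icc (0 : ℝ) 1, x ≤ y → |x - y| < ε / 2 / 5 ^ k →
      |tentConj c d n x - tentConj c d n y| < ε := by
    intro x hx y hy hxy h
    rw [abs_sub_comm, abs_of_nonneg (sub_nonneg.2 hxy), lt_div_iff₀' (by positivity)] at h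
    have h1 := abs_le.1 (abs_conjApprox_sub_tentConj_le hc hd k n hx)
    have h2 := abs_le.1 (abs_conjApprox_sub_tentConj_le hc hd k n hy)
    have h3 := conjApprox_sub_le hc hd k n hx hy hxy
    rw [abs_sub_comm, abs_of_nonneg (sub_nonneg.2 (tentConj_monotoneOn hc hd n hx hy hxy))]
    linarith [h1.2, h2.1]
  intro x hx y hy h
  rcases le_total x y with hxy | hxy
  · exact key x hx y hy hxy h
  · rw [abs_sub_comm] at h ⊢
    exact key y hy x hx hxy h

end TentConj

lemma fEx_eq_tent {n : ℕ} (hn : 1 ≤ n) (x : ℝ) :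
    fEx n x = tent ((4 + (n : ℝ)) / (2 * n + 4)) x := by
  have hn' : (1 : ℝ) ≤ n := by exact_mod_cast hn
  have h : 1 - (4 + (n : ℝ)) / (2 * n + 4) = n / (2 * n + 4) := by
    field_simp
    ring
  rw [fEx, tent, h]
  congr 1 <;> field_simp

lemma gEx_eq_tent {n : ℕ} (hn : 1 ≤ n) (x : ℝ) :
    gEx n x = tent ((3 * (n : ℝ) - 1) / (4 * n + 4)) x := by
  have hn' : (1 : ℝ) ≤ n := by exact_mod_cast hn
  have h0 : 3 * (n : ℝ) - 1 ≠ 0 := by linarith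
  have h : 1 - (3 * (n : ℝ) - 1) / (4 * n + 4) = (n + 5) / (4 * n + 4) := by
    field_simp
    ring
  rw [gEx, tent, h]
  congr 1 <;> field_simp

/-- The nonautonomous systems `([0,1], (f_n)_{n ≥ 1})` and `([0,1], (g_n)_{n ≥ 1})`
are topologically conjugate: there is a sequence of order-preserving homeomorphisms
`h n : [0,1] → [0,1]`, equicontinuous together with their inverses, with
`h (n+1) ∘ f n = g n ∘ h n` for all `n ≥ 1`. -/
theorem fEx_topConjugate_gEx :
    ∃ h : ℕ → ℝ → ℝ,
      (∀ n : ℕ, 1 ≤ n → StrictMonoOn (h n) (Icc (0:ℝ) 1)) ∧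
      (∀ n : ℕ, 1 ≤ n → ContinuousOn (h n) (Icc (0:ℝ) 1)) ∧
      (∀ n : ℕ, 1 ≤ n → BijOn (h n) (Icc (0:ℝ) 1) (Icc (0:ℝ) 1)) ∧
      (∀ ε > (0:ℝ), ∃ δ > (0:ℝ), ∀ n : ℕ, 1 ≤ n →
        ∀ x ∈ Icc (0:ℝ) 1, ∀ y ∈ Icc (0:ℝ) 1, |x - y| < δ → |h n x - h n y| < ε) ∧
      (∀ ε > (0:ℝ), ∃ δ > (0:ℝ), ∀ n : ℕ, 1 ≤ n →
        ∀ x ∈ Icc (0:ℝ) 1, ∀ y ∈ Icc (0:ℝ) 1, |h n x - h n y| < δ → |x - y| < ε) ∧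
      (∀ n : ℕ, 1 ≤ n → ∀ x ∈ Icc (0:ℝ) 1, h (n + 1) (fEx n x) = gEx n (h n x)) := by
  set c : ℕ → ℝ := fun n => (4 + ((n + 1 : ℕ) : ℝ)) / (2 * (n + 1 : ℕ) + 4) with hc_def
  set d : ℕ → ℝ := fun n => (3 * ((n + 1 : ℕ) : ℝ) - 1) / (4 * (n + 1 : ℕ) + 4) with hd_def
  have hc : ∀ n, c n ∈ Icc (1 / 6 : ℝ) (5 / 6) := fun n => by
    have hn : (0 : ℝ) ≤ n := n.cast_nonneg
    simp only [hc_def, mem_Icc, Nat.cast_add, Nat.cast_one]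
    constructor
    · rw [div_le_div_iff₀ (by positivity) (by positivity)]
      linarith
    · rw [div_le_div_iff₀ (by positivity) (by positivity)]
      linarith
  have hd : ∀ n, d n ∈ Icc (1 / 6 : ℝ) (5 / 6) := fun n => by
    have hn : (0 : ℝ) ≤ n := n.cast_nonneg
    simp only [hd_def, mem_Icc, Nat.cast_add, Nat.cast_one]
    constructor
    · rw [div_le_div_iff₀ (by positivity) (by positivity)]
      linarith
    · rw [div_le_div_iff₀ (by positivity) (by positivity)]
      linarith
  have hmaps := fun n => (tentConj_fixesEndpoints hc hd n).mapsTo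
  have hinv := tentConj_leftInvOn hc hd
  refine ⟨fun n => tentConj c d (n - 1), fun n _ => ?_, fun n _ => ?_, fun n _ => ?_,
    fun ε hε => ?_, fun ε hε => ?_, fun n hn x hx => ?_⟩
  · exact (tentConj_monotoneOn hc hd _).strictMonoOn_of_injOn (hinv _).injOn
  · refine Metric.continuousOn_iff.2 fun y hy ε hε => ?_
    obtain ⟨δ, hδ, h⟩ := tentConj_equicontinuous hc hd hε
    exact ⟨δ, hδ, fun x hx hxy => h _ x hx y hy hxy⟩
  · exact InvOn.bijOn ⟨hinv _, tentConj_leftInvOn hd hc _⟩ (hmaps _)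
      (tentConj_fixesEndpoints hd hc _).mapsTo
  · obtain ⟨δ, hδ, h⟩ := tentConj_equicontinuous hc hd hε
    exact ⟨δ, hδ, fun n _ => h _⟩
  · obtain ⟨δ, hδ, h⟩ := tentConj_equicontinuous hd hc hε
    refine ⟨δ, hδ, fun n _ x hx y hy hxy => ?_⟩
    simpa only [hinv _ hx, hinv _ hy] using h (n - 1) _ (hmaps _ hx) _ (hmaps _ hy) hxy
  · obtain ⟨m, rfl⟩ := Nat.exists_eq_add_of_le' hn
    rw [fEx_eq_tent hn, gEx_eq_tent hn]
    simp only [Nat.add_sub_cancel]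
    rw [tentConj_eq_tentLift hc hd m hx]
    exact (tent_tentLift (mem_Ioo_of_mem_Icc (hc m)) (mem_Ioo_of_mem_Icc (hd m))
      (tentConj_fixesEndpoints hc hd (m + 1)) hx).symm
end
end
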